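/- Fix δ > 0, β > 0 and γ ∈ (1/2, 1]. For every binary qubit POVM in conical coordinates (w, λ, θ, φ) with purity 2(1 + λ²)w² = γ, the Δ-disturbance satisfies D^{(Δ)} ≥ δ²(2γ − 1)·sech²(βδ/2) / (4(γ + cosh(βδ) − γ cosh(βδ))), and equality holds for the semiclassical POVM with w = 1/2, λ = √(2γ − 1) and θ ∈ {0, π}. -/

import Mathlib

open Matrix ComplexOrder Real

noncomputable def pauliX : Matrix (Fin 2) (Fin 2) ℂ := !![0, 1; 1, 0]
noncomputable def pauliY : Matrix (Fin 2) (Fin 2) ℂ := !![0, -Complex.I; Complex.I, 0]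
noncomputable def pauliZ : Matrix (Fin 2) (Fin 2) ℂ := !![1, 0; 0, -1]

/-- The thermal qubit state `ρ_β = diag(e^{−βδ/2}, e^{βδ/2})/(2 cosh(βδ/2))`. -/
noncomputable def rhoTherm (δ β : ℝ) : Matrix (Fin 2) (Fin 2) ℂ :=
  ((2 * Real.cosh (β * δ / 2) : ℝ)⁻¹ : ℂ) •
    !![Complex.exp (-(β * δ / 2)), 0; 0, Complex.exp (β * δ / 2)]

/-- The POVM element `Π₀` of a binary qubit POVM in conical coordinates. -/
noncomputable def povm0 (w l θ φ : ℝ) : Matrix (Fin 2) (Fin 2) ℂ :=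
  (w : ℂ) • ((1 : Matrix (Fin 2) (Fin 2) ℂ)
    + ((l * Real.sin θ * Real.cos φ : ℝ) : ℂ) • pauliX
    + ((l * Real.sin θ * Real.sin φ : ℝ) : ℂ) • pauliY
    + ((l * Real.cos θ : ℝ) : ℂ) • pauliZ)

/-- The POVM element `Π₁ = I₂ − Π₀`. -/
noncomputable def povm1 (w l θ φ : ℝ) : Matrix (Fin 2) (Fin 2) ℂ :=
  1 - povm0 w l θ φ

/-- The outcome probability `p₀(β) = tr(ρ_β Π₀)`. -/
noncomputable def prob0 (δ β w l θ φ : ℝ) : ℝ :=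
  ((rhoTherm δ β * povm0 w l θ φ).trace).re

/-- The Fisher information of the measurement, `F_β = (dp₀/dβ)²/(p₀ p₁)`. -/
noncomputable def fisherInfo (δ β w l θ φ : ℝ) : ℝ :=
  (deriv (fun b => prob0 δ b w l θ φ) β) ^ 2 /
    (prob0 δ β w l θ φ * (1 - prob0 δ β w l θ φ))
/-- The quantum Fisher information `F^Q = δ²/(2 + 2cosh(βδ))` of the thermal qubit model. -/
noncomputable def qfiModel (δ β : ℝ) : ℝ := δ ^ 2 / (2 + 2 * Real.cosh (β * δ))

/-- The QFI `Q₀` of the post-measurement state for outcome 0. -/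
noncomputable def qfiPost0 (δ β l θ : ℝ) : ℝ :=
  δ ^ 2 * (1 - l ^ 2) * Real.exp (β * δ) /
    ((1 + l * Real.cos θ) + Real.exp (β * δ) * (1 - l * Real.cos θ)) ^ 2

/-- The QFI `Q₁` of the post-measurement state for outcome 1. -/
noncomputable def qfiPost1 (δ β w l θ : ℝ) : ℝ :=
  δ ^ 2 * ((1 - w) ^ 2 - l ^ 2 * w ^ 2) * Real.exp (β * δ) /
    (1 - w * (1 + l * Real.cos θ) + Real.exp (β * δ) * (1 - w * (1 - l * Real.cos θ))) ^ 2

/-- The Δ-disturbance (information loss) `D^{(Δ)} = F^Q − p₀Q₀ − p₁Q₁`. -/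
noncomputable def deltaDist (δ β w l θ φ : ℝ) : ℝ :=
  qfiModel δ β - prob0 δ β w l θ φ * qfiPost0 δ β l θ -
    (1 - prob0 δ β w l θ φ) * qfiPost1 δ β w l θ
lemma exp_eq_sq_cosh_add_sinh (x : ℝ) :
    Real.exp (2 * x) = (Real.cosh x + Real.sinh x) ^ 2 := by
  rw [Real.cosh_add_sinh, ← Real.exp_nat_mul]
  norm_num

lemma prob0_eq (δ β w l θ φ : ℝ) :
    prob0 δ β w l θ φ = w * (Real.cosh (β * δ / 2) - l * Real.cos θ * Real.sinh (β * δ / 2)) /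
      Real.cosh (β * δ / 2) := by
  have e1 : Complex.exp (-(β * δ / 2)) = ((Real.exp (-(β * δ / 2)) : ℝ) : ℂ) := by push_cast; rfl
  have e2 : Complex.exp (β * δ / 2) = ((Real.exp (β * δ / 2) : ℝ) : ℂ) := by push_cast; rfl
  have hC := (Real.cosh_pos (β * δ / 2)).ne'
  unfold prob0 rhoTherm povm0 pauliX pauliY pauliZ
  rw [e1, e2]
  simp only [Matrix.trace_fin_two, Matrix.mul_apply, Fin.sum_univ_two, Matrix.smul_apply,
    Matrix.add_apply, Matrix.of_apply, Matrix.cons_val', Matrix.cons_val_zero,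
    Matrix.cons_val_one, Matrix.one_apply_eq, smul_eq_mul, mul_zero, zero_mul, add_zero,
    mul_one, mul_neg, Matrix.cons_val_fin_one, zero_add]
  rw [← Complex.ofReal_inv]
  norm_cast
  rw [← Real.cosh_sub_sinh, ← Real.cosh_add_sinh]
  field_simp
  ring

/-- The Δ-disturbance in terms of `C = cosh(βδ/2)` and `S = sinh(βδ/2)`. -/
lemma deltaDist_eq (δ β w l θ φ : ℝ)
    (hP : 0 < Real.cosh (β * δ / 2) - l * Real.cos θ * Real.sinh (β * δ / 2))
    (hR : 0 < Real.cosh (β * δ / 2) -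
      w * (Real.cosh (β * δ / 2) - l * Real.cos θ * Real.sinh (β * δ / 2))) :
    deltaDist δ β w l θ φ = δ ^ 2 / (4 * Real.cosh (β * δ / 2) ^ 2) *
      (1 - w * (1 - l ^ 2) * Real.cosh (β * δ / 2) /
          (Real.cosh (β * δ / 2) - l * Real.cos θ * Real.sinh (β * δ / 2)) -
        ((1 - w) ^ 2 - l ^ 2 * w ^ 2) * Real.cosh (β * δ / 2) /
          (Real.cosh (β * δ / 2) -
            w * (Real.cosh (β * δ / 2) - l * Real.cos θ * Real.sinh (β * δ / 2)))) := by
  unfold deltaDist qfiModel qfiPost0 qfiPost1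
  rw [prob0_eq, show β * δ = 2 * (β * δ / 2) by ring, exp_eq_sq_cosh_add_sinh, Real.cosh_two_mul,
    show 2 * (β * δ / 2) / 2 = β * δ / 2 by ring]
  have h1 := Real.cosh_sq_sub_sinh_sq (β * δ / 2)
  have hC := Real.cosh_pos (β * δ / 2)
  have hE : 0 < Real.cosh (β * δ / 2) + Real.sinh (β * δ / 2) := by
    rw [Real.cosh_add_sinh]; exact Real.exp_pos _
  generalize Real.cosh (β * δ / 2) = C at *
  generalize Real.sinh (β * δ / 2) = S at *
  generalize hu : l * Real.cos θ = u at *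
  have d1 : (1 + u + (C + S) ^ 2 * (1 - u)) = 2 * (C + S) * (C - u * S) := by
    linear_combination (-(1 + u)) * h1
  have d2 : (1 - w * (1 + u) + (C + S) ^ 2 * (1 - w * (1 - u))) =
      2 * (C + S) * (C - w * (C - u * S)) := by
    linear_combination (-(1 - w * (1 + u))) * h1
  have d3 : 2 + 2 * (C ^ 2 + S ^ 2) = 4 * C ^ 2 := by linear_combination (-2) * h1
  rw [d1, d2, d3]
  have d4 : 1 - w * (C - u * S) / C = (C - w * (C - u * S)) / C := by field_simp
  rw [d4]
  generalize hp : C - u * S = P at *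
  generalize hr : C - w * P = R at *
  field_simp
  ring

lemma bound_eq (δ β γ : ℝ) :
    δ ^ 2 * (2 * γ - 1) * ((Real.cosh (β * δ / 2))⁻¹) ^ 2 /
        (4 * (γ + Real.cosh (β * δ) - γ * Real.cosh (β * δ))) =
      δ ^ 2 / (4 * Real.cosh (β * δ / 2) ^ 2) *
        ((2 * γ - 1) /
          (Real.cosh (β * δ / 2) ^ 2 - (2 * γ - 1) * Real.sinh (β * δ / 2) ^ 2)) := by
  have h1 := Real.cosh_sq_sub_sinh_sq (β * δ / 2)
  have h2 : γ + Real.cosh (β * δ) - γ * Real.cosh (β * δ) =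
      Real.cosh (β * δ / 2) ^ 2 - (2 * γ - 1) * Real.sinh (β * δ / 2) ^ 2 := by
    rw [show β * δ = 2 * (β * δ / 2) by ring, Real.cosh_two_mul,
      show 2 * (β * δ / 2) / 2 = β * δ / 2 by ring]
    linear_combination (-γ) * h1
  rw [h2]
  simp only [div_eq_mul_inv, mul_inv, inv_pow]
  ring

lemma purity_poly_le (w r : ℝ) (hw' : w ≤ 1 / 2) (hr : 0 ≤ r) (hrw : r ≤ w)
    (hw : 7 / 20 ≤ w) :
    (4 * w ^ 2 + 4 * r ^ 2 - 1) * (w * (1 - w) + (1 - 2 * w) * r) ≤ r ^ 2 := by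
  obtain ⟨e, rfl⟩ : ∃ e, w = 1 / 2 - e := ⟨1 / 2 - w, by ring⟩
  have he : 0 ≤ e := by linarith
  have key : 0 ≤ 1 - e - 4 * e ^ 2 + 4 * e ^ 3 +
      r * (4 * e * r + 8 * e - 8 * e ^ 2 - 8 * r ^ 2) := by
    have hd : 0 ≤ 1 / 2 - e - r := by linarith
    have he' : 0 ≤ 3 / 20 - e := by linarith
    have hr3 : r ^ 3 ≤ (1 / 2 - e) ^ 2 * r := by
      nlinarith [mul_nonneg (mul_nonneg hr hd) (by linarith : 0 ≤ 1 / 2 - e + r)]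
    nlinarith [mul_nonneg he hr, mul_nonneg he he', mul_nonneg he hd,
      mul_nonneg (mul_nonneg he hr) hr, mul_nonneg (mul_nonneg he hr) he',
      mul_nonneg (mul_nonneg he hr) hd, mul_nonneg (mul_nonneg he he) he,
      mul_nonneg (mul_nonneg he he) he', mul_nonneg (mul_nonneg he he) hd]
  nlinarith [mul_nonneg he key]

/-- `C` and `S` play the roles of `cosh(βδ/2)` and `sinh(βδ/2)`, and `u` that of `λ cos θ`. -/
lemma disturbance_bound (C S w l u : ℝ) (hC : 0 < C) (hS : 0 ≤ S) (hCS : C ^ 2 - S ^ 2 = 1)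
    (hw : 0 < w) (hw' : w ≤ 1 / 2) (hl : 0 ≤ l) (hl' : l ≤ 1) (hu : |u| ≤ l)
    (hg : 1 / 4 < (1 + l ^ 2) * w ^ 2) (hg' : (1 + l ^ 2) * w ^ 2 ≤ 1 / 2)
    (hP : 0 < C - u * S) (hR : 0 < C - w * (C - u * S)) :
    (4 * (1 + l ^ 2) * w ^ 2 - 1) / (C ^ 2 - (4 * (1 + l ^ 2) * w ^ 2 - 1) * S ^ 2) ≤
      1 - w * (1 - l ^ 2) * C / (C - u * S) -
        ((1 - w) ^ 2 - l ^ 2 * w ^ 2) * C / (C - w * (C - u * S)) := by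
  have hSC : S ≤ C := by nlinarith
  have hw2 : 7 / 20 ≤ w := by
    have : l ^ 2 ≤ 1 := by nlinarith
    nlinarith [mul_nonneg (sq_nonneg w) (sub_nonneg.2 this)]
  have hrw : w * l ≤ w := by nlinarith
  have key := purity_poly_le w (w * l) hw' (by positivity) hrw hw2
  obtain ⟨g, hgd⟩ : ∃ g, g = 4 * (1 + l ^ 2) * w ^ 2 - 1 := ⟨_, rfl⟩
  rw [← hgd]
  rw [show 4 * w ^ 2 + 4 * (w * l) ^ 2 - 1 = g by rw [hgd]; ring] at key
  have hg0 : 0 < g := by linarith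
  have hg1 : g ≤ 1 := by linarith
  have hN : 0 < C ^ 2 - g * S ^ 2 := by nlinarith [sq_nonneg S]
  have hu2 : u ^ 2 ≤ l ^ 2 := sq_le_sq.2 (by rwa [abs_of_nonneg hl])
  have hq2 : (w * u * S) ^ 2 ≤ (w * l) ^ 2 * S ^ 2 := by
    have := mul_le_mul_of_nonneg_left hu2 (by positivity : 0 ≤ w ^ 2 * S ^ 2)
    linarith
  have hX : C * (w * (1 - w)) - (1 - 2 * w) * (w * u * S) ≤
      C * (w * (1 - w) + (1 - 2 * w) * (w * l)) := by
    have h1 : -(u * S) ≤ l * C := by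
      have : -u ≤ l := (neg_le_abs u).trans hu
      calc -(u * S) = -u * S := by ring
        _ ≤ l * S := by gcongr
        _ ≤ l * C := by gcongr
    have h2 := mul_le_mul_of_nonneg_left h1
      (mul_nonneg (by linarith : 0 ≤ 1 - 2 * w) hw.le)
    linarith
  have main : 0 ≤ -g * (C * (w * (1 - w)) - (1 - 2 * w) * (w * u * S)) +
      C * (w * l) ^ 2 * (C ^ 2 - g * S ^ 2) - C * (1 - g) * (w * u * S) ^ 2 := by
    have h1 := mul_le_mul_of_nonneg_left hX hg0.le
    have h2 := mul_le_mul_of_nonneg_left key hC.le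
    have h3 := mul_le_mul_of_nonneg_left hq2 (mul_nonneg hC.le (by linarith : 0 ≤ 1 - g))
    have h4 : C * (w * l) ^ 2 * (C ^ 2 - S ^ 2) = C * (w * l) ^ 2 := by rw [hCS, mul_one]
    linarith
  rw [← sub_nonneg]
  have heq : 1 - w * (1 - l ^ 2) * C / (C - u * S) -
        ((1 - w) ^ 2 - l ^ 2 * w ^ 2) * C / (C - w * (C - u * S)) - g / (C ^ 2 - g * S ^ 2) =
      C * (-g * (C * (w * (1 - w)) - (1 - 2 * w) * (w * u * S)) +
      C * (w * l) ^ 2 * (C ^ 2 - g * S ^ 2) - C * (1 - g) * (w * u * S) ^ 2) /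
      (w * (C - u * S) * (C - w * (C - u * S)) * (C ^ 2 - g * S ^ 2)) := by
    have hgN : g / (C ^ 2 - g * S ^ 2) = 1 - C ^ 2 * (1 - g) / (C ^ 2 - g * S ^ 2) := by
      rw [eq_sub_iff_add_eq, ← add_div, div_eq_one_iff_eq hN.ne']
      linear_combination (-g) * hCS
    have hX1 : -g * (C * (w * (1 - w)) - (1 - 2 * w) * (w * u * S)) =
        -g * (C * (w * (1 - w)) - (1 - 2 * w) * (w * u * S)) * (C ^ 2 - S ^ 2) := by
      rw [hCS, mul_one]
    rw [hgN, hX1]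
    have n1 := hP.ne'
    have n2 := hR.ne'
    have n3 : C ^ 2 - S ^ 2 * g ≠ 0 := by rw [mul_comm]; exact hN.ne'
    field_simp
    ring
  rw [heq]
  positivity

/-- For fixed purity `γ > 1/2`, the minimum Δ-disturbance is
`δ²(2γ−1)sech²(βδ/2)/(4(γ + coshβδ − γcoshβδ))`, attained by the semiclassical
POVM with `w = 1/2`, `λ = √(2γ−1)`, `θ ∈ {0, π}`. -/
theorem stmt12 (δ β γ : ℝ) (hδ : 0 < δ) (hβ : 0 < β) (hγ : 1 / 2 < γ) (hγ' : γ ≤ 1) :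
    (∀ w l θ φ : ℝ, 0 < w → w ≤ 1 / 2 → 0 ≤ l → l ≤ 1 →
      0 ≤ θ → θ ≤ π → 0 ≤ φ → φ < 2 * π → 2 * (1 + l ^ 2) * w ^ 2 = γ →
      deltaDist δ β w l θ φ ≥
        δ ^ 2 * (2 * γ - 1) * ((Real.cosh (β * δ / 2))⁻¹) ^ 2 /
          (4 * (γ + Real.cosh (β * δ) - γ * Real.cosh (β * δ))))
    ∧ (∀ θ φ : ℝ, (θ = 0 ∨ θ = π) → 0 ≤ φ → φ < 2 * π →
      deltaDist δ β (1 / 2) (Real.sqrt (2 * γ - 1)) θ φ =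
        δ ^ 2 * (2 * γ - 1) * ((Real.cosh (β * δ / 2))⁻¹) ^ 2 /
          (4 * (γ + Real.cosh (β * δ) - γ * Real.cosh (β * δ)))) := by
  set C := Real.cosh (β * δ / 2) with hCdef
  set S := Real.sinh (β * δ / 2) with hSdef
  have hC : 0 < C := Real.cosh_pos _
  have hS : 0 ≤ S := Real.sinh_nonneg_iff.2 (by positivity)
  have hCS : C ^ 2 - S ^ 2 = 1 := Real.cosh_sq_sub_sinh_sq _
  have hSC : S < C := by nlinarith
  have pos : ∀ u : ℝ, |u| ≤ 1 → 0 < C - u * S := fun u hu => by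
    nlinarith [mul_le_mul_of_nonneg_right ((le_abs_self u).trans hu) hS]
  have pos' : ∀ u w : ℝ, |u| ≤ 1 → 0 < w → w ≤ 1 / 2 → 0 < C - w * (C - u * S) :=
    fun u w hu hw hw' => by
      have h1 := mul_le_mul_of_nonneg_right ((neg_le_abs u).trans hu) hS
      have h2 : C - u * S < 2 * C := by linarith
      nlinarith [pos u hu]
  refine ⟨fun w l θ φ hw hw' hl hl' _ _ _ _ hγw => ?_, fun θ φ hθ _ _ => ?_⟩
  · have hu : |l * Real.cos θ| ≤ l := by
      rw [abs_mul, abs_of_nonneg hl]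
      exact mul_le_of_le_one_right hl (Real.abs_cos_le_one θ)
    have hP := pos _ (hu.trans hl')
    have hR := pos' _ w (hu.trans hl') hw hw'
    rw [bound_eq, deltaDist_eq δ β w l θ φ hP hR, ge_iff_le]
    refine mul_le_mul_of_nonneg_left ?_ (by positivity)
    have := disturbance_bound C S w l _ hC hS hCS hw hw' hl hl' hu
      (by linarith) (by linarith) hP hR
    rwa [show 4 * (1 + l ^ 2) * w ^ 2 - 1 = 2 * γ - 1 by linarith] at this
  · have hl2 : Real.sqrt (2 * γ - 1) ^ 2 = 2 * γ - 1 := Real.sq_sqrt (by linarith)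
    have hu : |Real.sqrt (2 * γ - 1) * Real.cos θ| ≤ 1 := by
      rw [abs_mul, abs_of_nonneg (Real.sqrt_nonneg _)]
      exact mul_le_one₀ (Real.sqrt_le_one.2 (by linarith)) (abs_nonneg _)
        (Real.abs_cos_le_one θ)
    have hP := pos _ hu
    have hR := pos' _ (1 / 2) hu (by norm_num) le_rfl
    rw [bound_eq, deltaDist_eq δ β (1 / 2) _ θ φ hP hR, ← hCdef, ← hSdef]
    congr 1
    have hu2 : (Real.sqrt (2 * γ - 1) * Real.cos θ) ^ 2 = 2 * γ - 1 := by
      rcases hθ with rfl | rfl <;> simp [hl2]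
    rw [hl2]
    generalize Real.sqrt (2 * γ - 1) * Real.cos θ = u at *
    rw [← hu2]
    have hM : 0 < C + u * S := by linarith only [hR]
    have hR' : C - 1 / 2 * (C - u * S) = (C + u * S) / 2 := by ring
    have hN : C ^ 2 - u ^ 2 * S ^ 2 = (C - u * S) * (C + u * S) := by ring
    rw [hR', hN]
    field_simp
    linear_combination 2 * u ^ 2 * hCS
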